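/- Every graph on n vertices has at most 3^{n/3} maximal independent sets. -/

import Mathlib

/-- `S` is an independent set of `G`: no two of its vertices are adjacent. -/
def IsIndepSet {V : Type*} (G : SimpleGraph V) (S : Set V) : Prop :=
  S.Pairwise fun a b => ¬ G.Adj a b

section MoonMoser
open Classical Finset

/-- Maximal independent subsets of the graph induced on `U`. -/
noncomputable def misFam {V : Type*} (G : SimpleGraph V) (U : Finset V) : Finset (Finset V) :=
  U.powerset.filter fun S => (∀ a ∈ S, ∀ b ∈ S, ¬ G.Adj a b) ∧
    ∀ w ∈ U, w ∉ S → ∃ x ∈ S, G.Adj x w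

/-- Closed neighbourhood of `u` in `U`. -/
noncomputable def closedNbr {V : Type*} (G : SimpleGraph V) (U : Finset V) (u : V) : Finset V :=
  U.filter fun w => w = u ∨ G.Adj u w

theorem cube_le_three_pow (k : ℕ) : k ^ 3 ≤ 3 ^ k := by
  rcases Nat.lt_or_ge k 3 with h | h
  · interval_cases k <;> norm_num
  · induction k, h using Nat.le_induction with
    | base => norm_num
    | succ n hn ih =>
      rw [pow_succ 3 n]
      have h1 : 3 * n ^ 2 ≤ n ^ 3 := by
        rw [pow_succ n 2, mul_comm]; exact Nat.mul_le_mul_left _ hn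
      nlinarith

theorem misFam_subset {V : Type*} (G : SimpleGraph V) (U : Finset V) (v : V) (hv : v ∈ U) :
    misFam G U ⊆ (closedNbr G U v).biUnion fun u =>
      (misFam G (U \ closedNbr G U u)).image (insert u) := by
  intro S hS
  simp only [misFam, mem_filter, mem_powerset] at hS
  obtain ⟨hSU, hind, hmax⟩ := hS
  have : ∃ u ∈ S, u = v ∨ G.Adj v u := by
    by_cases h : v ∈ S
    · exact ⟨v, h, Or.inl rfl⟩
    · obtain ⟨x, hx, hxa⟩ := hmax v hv h
      exact ⟨x, hx, Or.inr hxa.symm⟩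
  obtain ⟨u, huS, hu⟩ := this
  refine mem_biUnion.2 ⟨u, mem_filter.2 ⟨hSU huS, hu⟩, mem_image.2 ⟨S.erase u, ?_, insert_erase huS⟩⟩
  refine mem_filter.2 ⟨mem_powerset.2 ?_, ?_, ?_⟩
  · intro w hw
    have hw' := mem_erase.1 hw
    simp only [closedNbr, mem_sdiff, mem_filter]
    refine ⟨hSU hw'.2, ?_⟩
    rintro ⟨_, h | h⟩
    · exact hw'.1 h
    · exact hind u huS w hw'.2 h
  · intro a ha b hb
    exact hind a (mem_of_mem_erase ha) b (mem_of_mem_erase hb)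
  · intro w hw hwS
    simp only [closedNbr, mem_sdiff, mem_filter, not_and, not_or] at hw
    obtain ⟨hwU, hw2⟩ := hw
    obtain ⟨hne, hna⟩ := hw2 hwU
    obtain ⟨x, hx, hxa⟩ := hmax w hwU (fun h => hwS (mem_erase.2 ⟨hne, h⟩))
    refine ⟨x, mem_erase.2 ⟨?_, hx⟩, hxa⟩
    rintro rfl
    exact hna hxa

theorem misFam_card {V : Type*} (G : SimpleGraph V) (U : Finset V) :
    (misFam G U).card ^ 3 ≤ 3 ^ U.card := by
  induction U using Finset.strongInduction with
  | H U ih =>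
  rcases U.eq_empty_or_nonempty with rfl | hne
  · have : (misFam G ∅).card ≤ 1 := (card_filter_le _ _).trans (by simp)
    simpa using Nat.pow_le_pow_left this 3
  obtain ⟨v, hv, hmin⟩ := exists_min_image U (fun u => (closedNbr G U u).card) hne
  have hself : ∀ u ∈ U, u ∈ closedNbr G U u := fun u hu => mem_filter.2 ⟨hu, Or.inl rfl⟩
  obtain ⟨m, hm, hmm⟩ := exists_max_image (closedNbr G U v)
    (fun u => (misFam G (U \ closedNbr G U u)).card) ⟨v, hself v hv⟩
  have hsub : ∀ u, closedNbr G U u ⊆ U := fun u => filter_subset _ _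
  have hmU := hsub v hm
  have h1 : (misFam G U).card ≤
      (closedNbr G U v).card * (misFam G (U \ closedNbr G U m)).card := by
    refine (card_le_card (misFam_subset G U v hv)).trans ?_
    exact card_biUnion_le_card_mul _ _ _ fun u hu => card_image_le.trans (hmm u hu)
  have h2 := ih (U \ closedNbr G U m) (sdiff_ssubset (hsub m) ⟨m, hself m hmU⟩)
  have h3 := card_sdiff_add_card_eq_card (hsub m)
  have h4 := hmin m hmU
  calc (misFam G U).card ^ 3 ≤ _ := Nat.pow_le_pow_left h1 3
    _ = (closedNbr G U v).card ^ 3 * (misFam G (U \ closedNbr G U m)).card ^ 3 := mul_pow _ _ _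
    _ ≤ 3 ^ (closedNbr G U v).card * 3 ^ (U \ closedNbr G U m).card :=
      Nat.mul_le_mul (cube_le_three_pow _) h2
    _ = 3 ^ ((closedNbr G U v).card + (U \ closedNbr G U m).card) := (pow_add _ _ _).symm
    _ ≤ 3 ^ U.card := Nat.pow_le_pow_right (by norm_num) (by omega)

theorem natCard_le_misFam {V : Type*} [Fintype V] (G : SimpleGraph V) :
    Nat.card {S : Set V // IsIndepSet G S ∧
        ∀ T : Set V, IsIndepSet G T → S ⊆ T → S = T} ≤ (misFam G univ).card := by
  have hmem : ∀ S : {S : Set V // IsIndepSet G S ∧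
      ∀ T : Set V, IsIndepSet G T → S ⊆ T → S = T}, S.1.toFinset ∈ misFam G univ := by
    rintro ⟨S, hS, hmax⟩
    simp only [misFam, mem_filter, mem_powerset, Set.mem_toFinset]
    refine ⟨subset_univ _, ?_, ?_⟩
    · intro a ha b hb hab
      exact hS ha hb hab.ne hab
    · intro w _ hw
      by_contra hcon
      push Not at hcon
      have hT : IsIndepSet G (insert w S) := by
        rintro a (rfl | ha) b (rfl | hb) hab
        · exact absurd rfl hab
        · exact fun h => hcon b hb h.symm
        · exact hcon a ha
        · exact hS ha hb hab
      have := hmax _ hT (Set.subset_insert _ _)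
      exact hw (this ▸ Set.mem_insert w S)
  have hinj := Nat.card_le_card_of_injective (β := {x // x ∈ misFam G univ})
    (fun S => ⟨S.1.toFinset, hmem S⟩) (by
      intro S T h
      apply Subtype.ext
      exact Set.toFinset_inj.1 (Subtype.ext_iff.1 h))
  simpa using hinj

end MoonMoser

/-- Moon–Moser bound: a graph on `n` vertices has at most `3^(n/3)` maximal
independent sets. -/
theorem card_maximal_indepSets_le {V : Type*} [Fintype V] (G : SimpleGraph V) :
    (Nat.card {S : Set V // IsIndepSet G S ∧
        ∀ T : Set V, IsIndepSet G T → S ⊆ T → S = T} : ℝ) ≤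
      (3 : ℝ) ^ ((Fintype.card V : ℝ) / 3) := by
  have h : (Nat.card {S : Set V // IsIndepSet G S ∧
        ∀ T : Set V, IsIndepSet G T → S ⊆ T → S = T}) ^ 3 ≤ 3 ^ Fintype.card V :=
    (Nat.pow_le_pow_left (natCard_le_misFam G) 3).trans (misFam_card G Finset.univ)
  refine le_of_pow_le_pow_left₀ (n := 3) (by norm_num) (by positivity) ?_
  rw [← Real.rpow_natCast ((3 : ℝ) ^ _) 3, ← Real.rpow_mul (by norm_num)]
  have e : (Fintype.card V : ℝ) / 3 * ((3 : ℕ) : ℝ) = Fintype.card V := by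
    push_cast; ring
  rw [e, Real.rpow_natCast]
  exact_mod_cast h
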